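/- Let q be a prime power, 𝔽_q the finite field with q elements, and m a positive integer with gcd(m, q) = 1. Let a_1, a_2, a_3 be pairwise distinct elements of 𝔽_q and let u = (X − a_3) / ((X − a_1)(X − a_2)) be the corresponding element of the rational function field 𝔽_q(X). Then the polynomial Y^m − u is irreducible in 𝔽_q(X)[Y]. -/

import Mathlib

open Polynomial

/-- If a prime `p` divides `a` exactly once and `d` is coprime to `a`, then `Y ^ m - a / d` is
irreducible over the fraction field. -/
theorem irreducible_X_pow_sub_C_div {R K : Type*} [CommRing R] [IsDomain R]
    [IsGCDMonoid R] [Field K] [Algebra R K] [IsFractionRing R K]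
    {p a d : R} (hp : Prime p) (hpa : p ∣ a) (hpa2 : ¬ p ^ 2 ∣ a) (had : IsRelPrime a d)
    {m : ℕ} (hm : 0 < m) :
    Irreducible ((X : K[X]) ^ m - C (algebraMap R K a / algebraMap R K d)) := by
  have hpd : ¬ p ∣ d := fun h => hp.not_isUnit (had hpa h)
  have hd : d ≠ 0 := fun h => hpd (h ▸ dvd_zero p)
  have hdK : algebraMap R K d ≠ 0 := by simpa using hd
  set f : R[X] := C d * X ^ m - C a with hf
  have hcoeff : ∀ n, f.coeff n = (if n = m then d else 0) - (if n = 0 then a else 0) := by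
    intro n
    simp [hf, coeff_X_pow, coeff_C]
  have hcoeff_m : f.coeff m = d := by simp [hcoeff, hm.ne']
  have hcoeff_zero : f.coeff 0 = -a := by simp [hcoeff, hm.ne]
  have hdeg : f.natDegree = m := by
    refine natDegree_eq_of_le_of_coeff_ne_zero ?_ (hcoeff_m ▸ hd)
    refine natDegree_le_iff_coeff_eq_zero.2 fun n hn => ?_
    rw [hcoeff, if_neg hn.ne', if_neg (by omega), sub_zero]
  have hprim : f.IsPrimitive := by
    intro r hr
    rw [C_dvd_iff_dvd_coeff] at hr
    exact had (by simpa [hcoeff_zero] using hr 0) (hcoeff_m ▸ hr m)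
  have hirr : Irreducible f := by
    refine irreducible_of_eisenstein_criterion (P := Ideal.span {p})
      ((Ideal.span_singleton_prime hp.ne_zero).2 hp) ?_ ?_ ?_ ?_ hprim
    · rwa [leadingCoeff, hdeg, hcoeff_m, Ideal.mem_span_singleton]
    · intro n hn
      have hnm : n ≠ m := hdeg ▸ (coe_lt_degree.1 hn).ne
      rw [Ideal.mem_span_singleton, hcoeff, if_neg hnm, zero_sub, dvd_neg]
      split_ifs
      exacts [hpa, dvd_zero p]
    · rwa [← natDegree_pos_iff_degree_pos, hdeg]
    · rwa [hcoeff_zero, Ideal.span_singleton_pow, Ideal.mem_span_singleton, dvd_neg]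
  rw [hprim.irreducible_iff_irreducible_map_fraction_map (K := K)] at hirr
  have hmap : f.map (algebraMap R K) =
      C (algebraMap R K d) * (X ^ m - C (algebraMap R K a / algebraMap R K d)) := by
    rw [mul_sub, ← C_mul, mul_div_cancel₀ _ hdK]
    simp [hf]
  rw [hmap] at hirr
  exact (irreducible_isUnit_mul (isUnit_C.2 hdK.isUnit)).1 hirr

/-- Kummer irreducibility underlying the `m`-friendly function fields for Matdot codes:
for a finite field `𝔽_q` (so `q = |𝔽_q|` is a prime power), `m` coprime to `q`, and
pairwise distinct elements `a₁, a₂, a₃` of `𝔽_q`, the polynomial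
`Y^m - (X - a₃) / ((X - a₁)(X - a₂))` is irreducible over the rational function field
`𝔽_q(X)`. -/
theorem kummer_irreducible_matdot_friendly
    {Fq : Type*} [Field Fq] [Fintype Fq]
    (m : ℕ) (hm : 0 < m) (hcop : Nat.Coprime m (Fintype.card Fq))
    (a₁ a₂ a₃ : Fq) (h12 : a₁ ≠ a₂) (h13 : a₁ ≠ a₃) (h23 : a₂ ≠ a₃) :
    Irreducible
      ((X : (RatFunc Fq)[X]) ^ m -
        C ((algebraMap (Polynomial Fq) (RatFunc Fq) (X - C a₃)) /
           (algebraMap (Polynomial Fq) (RatFunc Fq) ((X - C a₁) * (X - C a₂))))) := by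
  have hp := prime_X_sub_C a₃
  refine irreducible_X_pow_sub_C_div hp dvd_rfl (fun h => ?_) (IsCoprime.isRelPrime ?_) hm
  · rw [pow_two] at h
    exact hp.not_isUnit (hp.irreducible.squarefree _ h)
  · exact (isCoprime_X_sub_C_of_isUnit_sub (sub_ne_zero.2 h13.symm).isUnit).mul_right
      (isCoprime_X_sub_C_of_isUnit_sub (sub_ne_zero.2 h23.symm).isUnit)
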